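/- For every four-qubit state ψ = a·|0000⟩ + r·|D₂⁴⟩ + s·|1111⟩ with a ∈ ℝ, r, s ∈ ℂ and a² + |r|² + |s|² = 1, and any phases t_r, t_s ∈ ℝ satisfying the compatibility condition conj(r)·s·exp(I·t_s) = a·r·exp(I·t_r)·(1 − exp(I·t_r)) + conj(r)·s·exp(I·t_r), the state φ = a·|0000⟩ + r·exp(I·t_r)·|D₂⁴⟩ + s·exp(I·t_s)·|1111⟩ shares the same two-body marginals as ψ. That is, defining ψ(x) = a·[x = (0,0,0,0)] + r·D₂⁴(x) + s·[x = (1,1,1,1)] and φ(x) = a·[x = (0,0,0,0)] + r·exp(I·t_r)·D₂⁴(x) + s·exp(I·t_s)·[x = (1,1,1,1)], all six two-body marginals ρ_AB, ρ_AC, ρ_AD, ρ_BC, ρ_BD, ρ_CD of φ equal the corresponding marginals of ψ. -/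

import Mathlib

/-!
STATEMENT 14: For ψ = a·|0000⟩ + r·|D₂⁴⟩ + s·|1111⟩ and phases t_r, t_s
satisfying the compatibility condition
conj(r)·s·exp(I·t_s) = a·r·exp(I·t_r)·(1 − exp(I·t_r)) + conj(r)·s·exp(I·t_r),
the state φ = a·|0000⟩ + r·exp(I·t_r)·|D₂⁴⟩ + s·exp(I·t_s)·|1111⟩ shares the
same two-body marginals as ψ.
-/

noncomputable section

/-- The two-body marginal on parties A,B of a four-qubit pure state. -/
def rhoAB (ψ : Fin 2 × Fin 2 × Fin 2 × Fin 2 → ℂ) :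
    Matrix (Fin 2 × Fin 2) (Fin 2 × Fin 2) ℂ := fun p q =>
  ∑ c : Fin 2, ∑ d : Fin 2,
    ψ (p.1, p.2, c, d) * starRingEnd ℂ (ψ (q.1, q.2, c, d))

/-- The two-body marginal on parties A,C of a four-qubit pure state. -/
def rhoAC (ψ : Fin 2 × Fin 2 × Fin 2 × Fin 2 → ℂ) :
    Matrix (Fin 2 × Fin 2) (Fin 2 × Fin 2) ℂ := fun p q =>
  ∑ b : Fin 2, ∑ d : Fin 2,
    ψ (p.1, b, p.2, d) * starRingEnd ℂ (ψ (q.1, b, q.2, d))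

/-- The two-body marginal on parties A,D of a four-qubit pure state. -/
def rhoAD (ψ : Fin 2 × Fin 2 × Fin 2 × Fin 2 → ℂ) :
    Matrix (Fin 2 × Fin 2) (Fin 2 × Fin 2) ℂ := fun p q =>
  ∑ b : Fin 2, ∑ c : Fin 2,
    ψ (p.1, b, c, p.2) * starRingEnd ℂ (ψ (q.1, b, c, q.2))

/-- The two-body marginal on parties B,C of a four-qubit pure state. -/
def rhoBC (ψ : Fin 2 × Fin 2 × Fin 2 × Fin 2 → ℂ) :
    Matrix (Fin 2 × Fin 2) (Fin 2 × Fin 2) ℂ := fun p q =>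
  ∑ a : Fin 2, ∑ d : Fin 2,
    ψ (a, p.1, p.2, d) * starRingEnd ℂ (ψ (a, q.1, q.2, d))

/-- The two-body marginal on parties B,D of a four-qubit pure state. -/
def rhoBD (ψ : Fin 2 × Fin 2 × Fin 2 × Fin 2 → ℂ) :
    Matrix (Fin 2 × Fin 2) (Fin 2 × Fin 2) ℂ := fun p q =>
  ∑ a : Fin 2, ∑ c : Fin 2,
    ψ (a, p.1, c, p.2) * starRingEnd ℂ (ψ (a, q.1, c, q.2))

/-- The two-body marginal on parties C,D of a four-qubit pure state. -/
def rhoCD (ψ : Fin 2 × Fin 2 × Fin 2 × Fin 2 → ℂ) :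
    Matrix (Fin 2 × Fin 2) (Fin 2 × Fin 2) ℂ := fun p q =>
  ∑ a : Fin 2, ∑ b : Fin 2,
    ψ (a, b, p.1, p.2) * starRingEnd ℂ (ψ (a, b, q.1, q.2))

/-- Two four-qubit states share all six of their two-body marginals. -/
def SameTwoBodyMarginals (ψ φ : Fin 2 × Fin 2 × Fin 2 × Fin 2 → ℂ) : Prop :=
  rhoAB ψ = rhoAB φ ∧ rhoAC ψ = rhoAC φ ∧ rhoAD ψ = rhoAD φ ∧
  rhoBC ψ = rhoBC φ ∧ rhoBD ψ = rhoBD φ ∧ rhoCD ψ = rhoCD φ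

/-- The indicator function of `(0,0,0,0)`, i.e. the state |0000⟩. -/
def ket0000 : Fin 2 × Fin 2 × Fin 2 × Fin 2 → ℂ := fun x =>
  if x = (0, 0, 0, 0) then 1 else 0

/-- The indicator function of `(1,1,1,1)`, i.e. the state |1111⟩. -/
def ket1111 : Fin 2 × Fin 2 × Fin 2 × Fin 2 → ℂ := fun x =>
  if x = (1, 1, 1, 1) then 1 else 0

/-- The four-qubit W state: value 1/2 on the four tuples with exactly one entry
equal to 1, and 0 elsewhere. -/
def W4 : Fin 2 × Fin 2 × Fin 2 × Fin 2 → ℂ := fun x =>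
  if (x.1 : ℕ) + (x.2.1 : ℕ) + (x.2.2.1 : ℕ) + (x.2.2.2 : ℕ) = 1 then 1 / 2 else 0

/-- The four-qubit Dicke state with two excitations: value 1/√6 on the six tuples
with exactly two entries equal to 1, and 0 elsewhere. -/
def D24 : Fin 2 × Fin 2 × Fin 2 × Fin 2 → ℂ := fun x =>
  if (x.1 : ℕ) + (x.2.1 : ℕ) + (x.2.2.1 : ℕ) + (x.2.2.2 : ℕ) = 2
  then 1 / (Real.sqrt 6 : ℂ) else 0

open ComplexConjugate in
/-- Two permutation-symmetric four-qubit states, with amplitudes `f` and `g` depending only on the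
number of excitations, share their two-body marginals as soon as the marginals agree on
the symmetric pair indices. -/
theorem sameTwoBodyMarginals_of_symmetric {ψ φ : Fin 2 × Fin 2 × Fin 2 × Fin 2 → ℂ} {f g : ℕ → ℂ}
    (hψ : ∀ a b c d : Fin 2, ψ (a, b, c, d) = f (a + b + c + d))
    (hφ : ∀ a b c d : Fin 2, φ (a, b, c, d) = g (a + b + c + d))
    (h : ∀ i ≤ 2, ∀ j ≤ 2,
      f i * conj (f j) + 2 * (f (i + 1) * conj (f (j + 1))) + f (i + 2) * conj (f (j + 2)) =
      g i * conj (g j) + 2 * (g (i + 1) * conj (g (j + 1))) + g (i + 2) * conj (g (j + 2))) :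
    SameTwoBodyMarginals ψ φ := by
  refine ⟨?_, ?_, ?_, ?_, ?_, ?_⟩ <;>
  · ext ⟨p, p'⟩ ⟨q, q'⟩
    have key := h (p + p') (by omega) (q + q') (by omega)
    simp only [rhoAB, rhoAC, rhoAD, rhoBC, rhoBD, rhoCD, hψ, hφ, Fin.sum_univ_two,
      Fin.val_zero, Fin.val_one]
    convert key using 1 <;> ring_nf

/-- The amplitude, on basis states with `k` excitations, of `x|0000⟩ + y|D₂⁴⟩ + z|1111⟩`. -/
def dickeGHZAmplitude (x y z : ℂ) (k : ℕ) : ℂ :=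
  if k = 0 then x else if k = 2 then y * (1 / (Real.sqrt 6 : ℂ)) else if k = 4 then z else 0

theorem dickeGHZ_apply (x y z : ℂ) (a b c d : Fin 2) :
    x * ket0000 (a, b, c, d) + y * D24 (a, b, c, d) + z * ket1111 (a, b, c, d) =
      dickeGHZAmplitude x y z (a + b + c + d) := by
  fin_cases a <;> fin_cases b <;> fin_cases c <;> fin_cases d <;>
    simp [ket0000, ket1111, D24, dickeGHZAmplitude]

theorem mul_conj_exp_I_mul (t : ℝ) :
    Complex.exp (Complex.I * (t : ℂ)) * starRingEnd ℂ (Complex.exp (Complex.I * (t : ℂ))) = 1 := by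
  rw [← Complex.exp_conj, ← Complex.exp_add]
  simp

theorem Dicke_GHZ_phase_family_shares_two_body_marginals
    (a : ℝ) (r s : ℂ)
    (hnorm : a ^ 2 + ‖r‖ ^ 2 + ‖s‖ ^ 2 = 1)
    (tr ts : ℝ)
    (hcompat : starRingEnd ℂ r * s * Complex.exp (Complex.I * (ts : ℂ)) =
      (a : ℂ) * r * Complex.exp (Complex.I * (tr : ℂ)) *
        (1 - Complex.exp (Complex.I * (tr : ℂ))) +
      starRingEnd ℂ r * s * Complex.exp (Complex.I * (tr : ℂ)))
    (ψ φ : Fin 2 × Fin 2 × Fin 2 × Fin 2 → ℂ)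
    (hψ : ∀ x, ψ x = (a : ℂ) * ket0000 x + r * D24 x + s * ket1111 x)
    (hφ : ∀ x, φ x = (a : ℂ) * ket0000 x +
      r * Complex.exp (Complex.I * (tr : ℂ)) * D24 x +
      s * Complex.exp (Complex.I * (ts : ℂ)) * ket1111 x) :
    SameTwoBodyMarginals φ ψ := by
  refine sameTwoBodyMarginals_of_symmetric
    (fun b c d e => (hφ _).trans (dickeGHZ_apply _ _ _ b c d e))
    (fun b c d e => (hψ _).trans (dickeGHZ_apply _ _ _ b c d e)) ?_
  have hu := mul_conj_exp_I_mul tr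
  have hv := mul_conj_exp_I_mul ts
  generalize Complex.exp (Complex.I * (tr : ℂ)) = u at *
  generalize Complex.exp (Complex.I * (ts : ℂ)) = v at *
  have hcoh : a * r * u + starRingEnd ℂ r * s * v * starRingEnd ℂ u =
      a * r + starRingEnd ℂ r * s := by
    linear_combination starRingEnd ℂ u * hcompat +
      (a * r * (1 - u) + starRingEnd ℂ r * s) * hu
  have hcoh' := congrArg (starRingEnd ℂ) hcoh
  simp only [map_add, map_mul, Complex.conj_conj, Complex.conj_ofReal] at hcoh'
  intro i hi j hj
  interval_cases i <;> interval_cases j <;> simp [dickeGHZAmplitude]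
  · linear_combination r * starRingEnd ℂ r * ((√6 : ℝ) : ℂ)⁻¹ ^ 2 * hu
  · linear_combination ((√6 : ℝ) : ℂ)⁻¹ * hcoh'
  · linear_combination r * starRingEnd ℂ r * ((√6 : ℝ) : ℂ)⁻¹ ^ 2 * hu
  · linear_combination ((√6 : ℝ) : ℂ)⁻¹ * hcoh
  · linear_combination r * starRingEnd ℂ r * ((√6 : ℝ) : ℂ)⁻¹ ^ 2 * hu + s * starRingEnd ℂ s * hv

end
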